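/- For every real constant c > 0, all integers n and k with 2 ≤ k ≤ n − 2c·√(n·log₂ n), and every real ε with 0 < ε < 1, there exists a set S of n points in ℝ² and a partition of S into k nonempty subsets C_1, …, C_k such that the following holds: for every subgraph G = (S, E) of the complete k-partite geometric graph K = K_{C_1…C_k} with at most c²·n·log₂ n edges, the stretch factor of G is at least 3 − ε; that is, there exist points p, q ∈ S lying in different subsets with δ_E(p,q) ≥ (3 − ε)·δ_K(p,q). -/

import Mathlib

open scoped ENNReal

/-- The length of a walk, given as the list of its vertices: the sum of the
Euclidean distances between consecutive vertices. -/
noncomputable def walkLen {P : Type*} [PseudoEMetricSpace P] (xs : List P) : ℝ≥0∞ :=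
  (List.zipWith edist xs xs.tail).sum

/-- `xs` is a walk from `p` to `q` in the graph with edge set `E`:
a nonempty finite sequence starting at `p`, ending at `q`, each consecutive
unordered pair being an edge of `E`. -/
def IsWalk {P : Type*} (E : Set (Sym2 P)) (p q : P) (xs : List P) : Prop :=
  xs.head? = some p ∧ xs.getLast? = some q ∧ xs.Chain' (fun a b => s(a, b) ∈ E)

/-- Graph distance: the infimum of lengths of walks from `p` to `q`
(`∞` if no walk exists). -/
noncomputable def gdist {P : Type*} [PseudoEMetricSpace P] (E : Set (Sym2 P)) (p q : P) :
    ℝ≥0∞ :=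
  ⨅ (xs : List P) (_ : IsWalk E p q xs), walkLen xs

/-- The edge set of the complete `k`-partite geometric graph whose color
classes are `C 0, …, C (k-1)`: all unordered pairs of points lying in two
different classes. -/
def kpartiteEdges {P : Type*} {k : ℕ} (C : Fin k → Set P) : Set (Sym2 P) :=
  {e | ∃ p q : P, e = s(p, q) ∧ ∃ i j : Fin k, i ≠ j ∧ p ∈ C i ∧ q ∈ C j}

/-- The length of a walk is at least the distance between its endpoints. -/
lemma edist_le_walkLen {P : Type*} [PseudoEMetricSpace P] {q : P} :
    ∀ (xs : List P) (p : P), (p :: xs).getLast? = some q → edist p q ≤ walkLen (p :: xs)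
  | [], p, h => by
    obtain rfl : p = q := by simpa using h
    simp
  | x :: xs, p, h => by
    have ih := edist_le_walkLen xs x (by simpa using h)
    calc edist p q ≤ edist p x + edist x q := edist_triangle _ _ _
      _ ≤ edist p x + walkLen (x :: xs) := by gcongr
      _ = walkLen (p :: x :: xs) := by simp [walkLen]

/-- If `p` and `q` are not adjacent, and every walk leaving `p` either starts with a step of
length at least `3` or has two steps of length at least `1` leading to a vertex at distance
at least `1` from `q`, then the graph distance of `p` and `q` is at least `3`. -/
lemma three_le_gdist {P : Type*} [PseudoEMetricSpace P] {E : Set (Sym2 P)} {p q : P}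
    (hpq : p ≠ q) (hE : s(p, q) ∉ E)
    (h : ∀ x, s(p, x) ∈ E → 3 ≤ edist p x ∨
      (1 ≤ edist p x ∧ ∀ y, s(x, y) ∈ E → 1 ≤ edist x y ∧ 1 ≤ edist y q)) :
    3 ≤ gdist E p q := by
  refine le_iInf₂ fun xs hxs => ?_
  obtain ⟨hp, hq, hc⟩ := hxs
  match xs, hp, hq, hc with
  | [_], hp, hq, _ => simp_all
  | [a, b], hp, hq, hc =>
    obtain rfl : a = p := by simpa using hp
    obtain rfl : b = q := by simpa using hq
    exact absurd (List.isChain_cons_cons.1 hc).1 hE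
  | a :: x :: y :: l, hp, hq, hc =>
    obtain rfl : a = p := by simpa using hp
    obtain ⟨hax, hc⟩ := List.isChain_cons_cons.1 hc
    obtain ⟨hxy, -⟩ := List.isChain_cons_cons.1 hc
    have hl := edist_le_walkLen l y (q := q) (by simpa using hq)
    have hw : walkLen (a :: x :: y :: l) = edist a x + (edist x y + walkLen (y :: l)) := by
      simp [walkLen]
    rw [hw]
    obtain h3 | ⟨h1, h2⟩ := h x hax
    · exact h3.trans le_self_add
    · obtain ⟨h2, h4⟩ := h2 y hxy
      calc (3 : ℝ≥0∞) = 1 + (1 + 1) := by norm_num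
        _ ≤ _ := by gcongr; exact h4.trans hl

/-- The graph distance of the endpoints of an edge is at most its length. -/
lemma gdist_le_edist {P : Type*} [PseudoEMetricSpace P] {E : Set (Sym2 P)} {p q : P}
    (h : s(p, q) ∈ E) : gdist E p q ≤ edist p q := by
  refine (iInf₂_le [p, q] ?_).trans (by simp [walkLen])
  exact ⟨rfl, rfl, List.isChain_cons_cons.2 ⟨h, List.isChain_singleton _⟩⟩

/-- Positions on a line of two clusters of `a` and `b` points, roughly at distance `1`, and of
further points roughly at distance `3` from the first cluster. -/
noncomputable def clusterPos (a b : ℕ) (d : ℝ) (i : ℕ) : ℝ :=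
  d * i + if i < a then 0 else if i < a + b then 1 else 3

/-- The color of a point: each cluster has a color, each of the further points its own. -/
def clusterColor (a b i : ℕ) : ℕ :=
  if i < a then 0 else if i < a + b then 1 else 2 + (i - (a + b))

lemma clusterPos_strictMono (a b : ℕ) {d : ℝ} (hd : 0 < d) : StrictMono (clusterPos a b d) := by
  intro i j hij
  have h : d * i < d * j := by gcongr
  unfold clusterPos
  split_ifs <;> linarith

/-- The points of the plane at the positions `clusterPos`. -/
noncomputable def clusterPt (a b : ℕ) (d : ℝ) (i : ℕ) : EuclideanSpace ℝ (Fin 2) :=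
  PiLp.single 2 0 (clusterPos a b d i)

lemma edist_clusterPt (a b : ℕ) (d : ℝ) (i j : ℕ) :
    edist (clusterPt a b d i) (clusterPt a b d j)
      = ENNReal.ofReal |clusterPos a b d i - clusterPos a b d j| := by
  rw [clusterPt, clusterPt, edist_dist, PiLp.dist_single_same, Real.dist_eq]

lemma clusterPt_injective (a b : ℕ) {d : ℝ} (hd : 0 < d) :
    Function.Injective (clusterPt a b d) := fun i j h => by
  have := congrArg (fun v : EuclideanSpace ℝ (Fin 2) => v 0) h
  simp only [clusterPt, PiLp.single_apply, if_true] at this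
  exact (clusterPos_strictMono a b hd).injective this

lemma le_edist_clusterPt {a b : ℕ} {d : ℝ} {i j : ℕ} {t : ℝ}
    (h : t ≤ clusterPos a b d j - clusterPos a b d i) :
    ENNReal.ofReal t ≤ edist (clusterPt a b d i) (clusterPt a b d j) := by
  rw [edist_clusterPt, abs_sub_comm]
  exact ENNReal.ofReal_le_ofReal (h.trans (le_abs_self _))

lemma le_clusterPos_sub {a b : ℕ} {d : ℝ} (hd : 0 < d) {i j : ℕ} (hi : i < a) (hj : a + b ≤ j) :
    3 ≤ clusterPos a b d j - clusterPos a b d i := by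
  have h : d * i ≤ d * j := by gcongr; omega
  simp only [clusterPos, if_pos hi, if_neg (show ¬ j < a by omega), if_neg hj.not_gt]
  linarith

lemma one_le_clusterPos_sub {a b : ℕ} {d : ℝ} (hd : 0 < d) {i j : ℕ} (hij : i < j)
    (hi : i < a + b) (hc : clusterColor a b i ≠ clusterColor a b j) :
    1 ≤ clusterPos a b d j - clusterPos a b d i := by
  have h : d * i ≤ d * j := by gcongr
  unfold clusterPos
  unfold clusterColor at hc
  split_ifs at hc ⊢ <;> first | linarith | omega

/-- Points of different colors, not both outside the clusters, are at distance at least `1`. -/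
lemma one_le_edist_clusterPt {a b : ℕ} {d : ℝ} (hd : 0 < d) {i j : ℕ}
    (hi : i < a + b) (hc : clusterColor a b i ≠ clusterColor a b j) :
    1 ≤ edist (clusterPt a b d i) (clusterPt a b d j) := by
  rw [← ENNReal.ofReal_one]
  rcases lt_trichotomy i j with hij | rfl | hij
  · exact le_edist_clusterPt (one_le_clusterPos_sub hd hij hi hc)
  · exact absurd rfl hc
  · rw [edist_comm]
    exact le_edist_clusterPt (one_le_clusterPos_sub hd hij (by omega) hc.symm)

/-- The color classes of the cluster configuration on `n` points. -/
def clusterClass (a b : ℕ) (d : ℝ) (n : ℕ) {k : ℕ} (c : Fin k) :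
    Set (EuclideanSpace ℝ (Fin 2)) :=
  clusterPt a b d '' {i | i < n ∧ clusterColor a b i = c}

lemma of_mem_kpartiteEdges_clusterClass {a b : ℕ} {d : ℝ} (hd : 0 < d) {n k i : ℕ}
    {x : EuclideanSpace ℝ (Fin 2)}
    (h : s(clusterPt a b d i, x) ∈ kpartiteEdges (clusterClass a b d n (k := k))) :
    ∃ j, x = clusterPt a b d j ∧ clusterColor a b i ≠ clusterColor a b j := by
  obtain ⟨p, q, he, u, v, huv, ⟨i', ⟨-, hi'⟩, rfl⟩, ⟨j', ⟨-, hj'⟩, rfl⟩⟩ := h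
  have huv' : (u : ℕ) ≠ v := fun h => huv (Fin.ext h)
  rcases Sym2.eq_iff.1 he with ⟨h1, h2⟩ | ⟨h1, h2⟩
  · obtain rfl := clusterPt_injective a b hd h1
    exact ⟨j', h2, by rwa [hi', hj']⟩
  · obtain rfl := clusterPt_injective a b hd h1
    exact ⟨i', h2, by rw [hi', hj']; exact huv'.symm⟩

/-- In a subgraph of the cluster configuration, nonadjacent points of the two clusters have
graph distance at least `3`. -/
lemma three_le_gdist_clusterPt {a b : ℕ} {d : ℝ} (hd : 0 < d) {n k : ℕ}
    {E : Set (Sym2 (EuclideanSpace ℝ (Fin 2)))}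
    (hE : E ⊆ kpartiteEdges (clusterClass a b d n (k := k))) {i j : ℕ}
    (hi : i < a) (haj : a ≤ j) (hj : j < a + b)
    (hij : s(clusterPt a b d i, clusterPt a b d j) ∉ E) :
    3 ≤ gdist E (clusterPt a b d i) (clusterPt a b d j) := by
  refine three_le_gdist (fun h => ?_) hij fun x hx => ?_
  · have := clusterPt_injective a b hd h
    omega
  obtain ⟨l, rfl, hl⟩ := of_mem_kpartiteEdges_clusterClass hd (hE hx)
  by_cases hlf : a + b ≤ l
  · left
    simpa using le_edist_clusterPt (le_clusterPos_sub hd hi hlf)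
  refine Or.inr ⟨one_le_edist_clusterPt hd (by omega) hl, fun y hy => ?_⟩
  obtain ⟨m, rfl, hm⟩ := of_mem_kpartiteEdges_clusterClass hd (hE hy)
  refine ⟨one_le_edist_clusterPt hd (by omega) hm, ?_⟩
  rw [edist_comm]
  refine one_le_edist_clusterPt hd hj ?_
  unfold clusterColor at *
  split_ifs at * <;> omega

/-- A graph with fewer than `a * b` edges misses an edge between the two clusters. -/
lemma exists_clusterPt_not_mem {a b : ℕ} {d : ℝ} (hd : 0 < d)
    {E : Finset (Sym2 (EuclideanSpace ℝ (Fin 2)))} (hE : E.card < a * b) :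
    ∃ i j, i < a ∧ a ≤ j ∧ j < a + b ∧ s(clusterPt a b d i, clusterPt a b d j) ∉ E := by
  by_contra! hall
  have hcard : (Finset.range a ×ˢ Finset.Ico a (a + b)).card ≤ E.card := by
    refine Finset.card_le_card_of_injOn
      (fun x => s(clusterPt a b d x.1, clusterPt a b d x.2)) ?_ ?_
    · rintro ⟨i, j⟩ h
      simp only [Finset.coe_product, Set.mem_prod, Finset.mem_coe, Finset.mem_range,
        Finset.mem_Ico] at h
      exact hall i j h.1 h.2.1 h.2.2
    · rintro ⟨i, j⟩ h ⟨i', j'⟩ h' he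
      simp only [Finset.coe_product, Set.mem_prod, Finset.mem_coe, Finset.mem_range,
        Finset.mem_Ico] at h h'
      rcases Sym2.eq_iff.1 he with ⟨h1, h2⟩ | ⟨h1, h2⟩
      · exact Prod.ext (clusterPt_injective a b hd h1) (clusterPt_injective a b hd h2)
      · have := clusterPt_injective a b hd h1
        omega
  simp only [Finset.card_product, Finset.card_range, Nat.card_Ico] at hcard
  rw [Nat.add_sub_cancel_left] at hcard
  omega

/-- Lower bound: for every `c > 0`, all `n, k` with
`2 ≤ k ≤ n − 2c·√(n·log₂ n)` and every `0 < ε < 1`, there is a set `S` of `n`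
points in `ℝ²` and a partition of `S` into `k` nonempty subsets such that every
subgraph of the complete `k`-partite geometric graph with at most
`c²·n·log₂ n` edges has stretch factor at least `3 − ε`. -/
theorem lower_bound_three (c : ℝ) (hc : 0 < c) (n k : ℕ) (hk2 : 2 ≤ k)
    (hkn : (k : ℝ) ≤ (n : ℝ) - 2 * c * Real.sqrt ((n : ℝ) * Real.logb 2 n))
    (ε : ℝ) (hε0 : 0 < ε) (hε1 : ε < 1) :
    ∃ (S : Finset (EuclideanSpace ℝ (Fin 2)))
      (Cl : Fin k → Set (EuclideanSpace ℝ (Fin 2))),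
      S.card = n ∧
      (∀ i, (Cl i).Nonempty) ∧
      (∀ i j, i ≠ j → Disjoint (Cl i) (Cl j)) ∧
      (⋃ i, Cl i) = ↑S ∧
      ∀ E : Finset (Sym2 (EuclideanSpace ℝ (Fin 2))),
        (↑E : Set (Sym2 (EuclideanSpace ℝ (Fin 2)))) ⊆ kpartiteEdges Cl →
        (E.card : ℝ) ≤ c ^ 2 * n * Real.logb 2 n →
        ∃ p ∈ S, ∃ q ∈ S, (∃ i j : Fin k, i ≠ j ∧ p ∈ Cl i ∧ q ∈ Cl j) ∧
          ENNReal.ofReal (3 - ε) * gdist (kpartiteEdges Cl) p q ≤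
            gdist (↑E : Set (Sym2 (EuclideanSpace ℝ (Fin 2)))) p q := by
  have hn2 : 2 ≤ n := by
    have h0 : 0 ≤ 2 * c * Real.sqrt ((n : ℝ) * Real.logb 2 n) := by positivity
    have : (k : ℝ) ≤ n := by linarith
    exact hk2.trans (by exact_mod_cast this)
  have hlog : 0 ≤ Real.logb 2 n := Real.logb_nonneg (by norm_num) (by exact_mod_cast by omega)
  have hm0 : 0 ≤ (n : ℝ) * Real.logb 2 n := by positivity
  have hsq := Real.sq_sqrt hm0
  have hkn' : k ≤ n := by
    have h0 : 0 ≤ 2 * c * Real.sqrt ((n : ℝ) * Real.logb 2 n) := by positivity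
    have : (k : ℝ) ≤ n := by linarith
    exact_mod_cast this
  obtain ⟨a, b, ha, hb, hab, hprod⟩ : ∃ a b : ℕ, 0 < a ∧ 0 < b ∧ a + b = n - k + 2 ∧
      (n - k) ^ 2 < 4 * (a * b) := by
    refine ⟨(n - k) / 2 + 1, (n - k + 1) / 2 + 1, by omega, by omega, by omega, ?_⟩
    obtain ⟨t, ht | ht⟩ := Nat.even_or_odd' (n - k)
    · rw [ht, show 2 * t / 2 = t by omega, show (2 * t + 1) / 2 = t by omega]
      nlinarith
    · rw [ht, show (2 * t + 1) / 2 = t by omega, show (2 * t + 1 + 1) / 2 = t + 1 by omega]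
      nlinarith
  have hprod' : c ^ 2 * n * Real.logb 2 n < (a * b : ℕ) := by
    have h1 : (((n - k : ℕ) : ℝ)) ^ 2 < 4 * ((a * b : ℕ) : ℝ) := by exact_mod_cast hprod
    rw [Nat.cast_sub hkn'] at h1
    have h2 : (2 * c * Real.sqrt ((n : ℝ) * Real.logb 2 n)) ^ 2 ≤ ((n : ℝ) - k) ^ 2 :=
      pow_le_pow_left₀ (by positivity) (by linarith) 2
    rw [mul_pow, hsq] at h2
    nlinarith
  have hn0 : (0 : ℝ) < n := by exact_mod_cast (by omega : 0 < n)
  set d : ℝ := ε / (3 * n) with hd_def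
  have hd : 0 < d := by positivity
  have hdn : d * n = ε / 3 := by rw [hd_def]; field_simp
  have hinj := clusterPt_injective a b hd
  refine ⟨(Finset.range n).map ⟨clusterPt a b d, hinj⟩, clusterClass a b d n, by simp, ?_, ?_, ?_,
    ?_⟩
  · intro i
    have hi := i.isLt
    refine Set.Nonempty.image _ ⟨if i.val = 0 then 0 else if i.val = 1 then a else i + (a + b) - 2,
      ?_, ?_⟩
    · split_ifs <;> omega
    · unfold clusterColor
      split_ifs <;> omega
  · intro i j hij
    rw [clusterClass, clusterClass, Set.disjoint_image_iff hinj, Set.disjoint_left]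
    rintro l ⟨-, h1⟩ ⟨-, h2⟩
    exact hij (Fin.ext (h1.symm.trans h2))
  · ext x
    simp only [clusterClass, Set.mem_iUnion, Set.mem_image, Set.mem_ofPred_eq, Finset.coe_map,
      Function.Embedding.coeFn_mk, Finset.coe_range, Set.mem_Iio]
    constructor
    · rintro ⟨_, l, ⟨hl, -⟩, rfl⟩
      exact ⟨l, hl, rfl⟩
    · rintro ⟨l, hl, rfl⟩
      refine ⟨⟨clusterColor a b l, ?_⟩, l, ⟨hl, rfl⟩, rfl⟩
      unfold clusterColor
      split_ifs <;> omega
  · intro E hE hcard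
    obtain ⟨i, j, hi, haj, hj, hij⟩ := exists_clusterPt_not_mem (d := d) (E := E)
      hd (by exact_mod_cast hcard.trans_lt hprod')
    have hcol : ∃ u v : Fin k, u ≠ v ∧ clusterPt a b d i ∈ clusterClass a b d n u ∧
        clusterPt a b d j ∈ clusterClass a b d n v := by
      refine ⟨⟨0, by omega⟩, ⟨1, by omega⟩, by simp, ⟨i, ⟨by omega, ?_⟩, rfl⟩,
        ⟨j, ⟨by omega, ?_⟩, rfl⟩⟩
      · simp [clusterColor, hi]
      · simp [clusterColor, hj, haj.not_gt]
    refine ⟨clusterPt a b d i, ?_, clusterPt a b d j, ?_, hcol, ?_⟩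
    · exact Finset.mem_map_of_mem _ (Finset.mem_range.2 (by omega))
    · exact Finset.mem_map_of_mem _ (Finset.mem_range.2 (by omega))
    have hlen : edist (clusterPt a b d i) (clusterPt a b d j) ≤ ENNReal.ofReal (1 + ε / 3) := by
      rw [edist_clusterPt]
      refine ENNReal.ofReal_le_ofReal ?_
      have h1 : d * j ≤ d * n := by gcongr; omega
      have h2 : d * i ≤ d * j := by gcongr; omega
      have h3 : 0 ≤ d * i := by positivity
      simp only [clusterPos, if_pos hi, if_pos hj, if_neg haj.not_gt]
      rw [abs_le]
      constructor <;> linarith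
    calc ENNReal.ofReal (3 - ε) * gdist (kpartiteEdges (clusterClass a b d n))
          (clusterPt a b d i) (clusterPt a b d j)
        ≤ ENNReal.ofReal (3 - ε) * ENNReal.ofReal (1 + ε / 3) := by
          gcongr
          refine (gdist_le_edist ?_).trans hlen
          exact ⟨_, _, rfl, hcol⟩
      _ = ENNReal.ofReal ((3 - ε) * (1 + ε / 3)) := (ENNReal.ofReal_mul (by linarith)).symm
      _ ≤ ENNReal.ofReal 3 := ENNReal.ofReal_le_ofReal (by nlinarith)
      _ = 3 := by simp
      _ ≤ _ := three_le_gdist_clusterPt hd hE hi haj hj hij
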